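/- arXiv:2502.12264 — 6 statements merged into one kernel-verified Lean document; each statement's English description precedes it below -/
import Mathlib

section
/- Let E be a real inner product space, let w ∈ E with ‖w‖ = 1 and a ∈ ℝ, and let H := {y : ⟪y, w⟫ ≥ a}. Suppose x ∈ E satisfies ⟪x, w⟫ < a, and let R := x + 2·(a − ⟪x, w⟫) • w. Then for every x₁ ∈ H and every x₂ ∈ E, dist(x, x₁) + dist(x₁, x₂) ≥ dist(R, x₂). (In words: the cost of any two-step path from x whose intermediate point passes the half-space H is at least the distance from the reflected point R to the final point.) -/
open scoped RealInnerProductSpace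

/-- The cost of any two-step path from `x` whose intermediate point lies in the closed
half-space `H = {y | a ≤ ⟪y, w⟫}` is at least the distance from the reflection `R` of `x`
across the boundary hyperplane to the final point. -/
theorem twoStep_cost_ge_dist_reflection
    {E : Type*} [NormedAddCommGroup E] [InnerProductSpace ℝ E]
    (w : E) (hw : ‖w‖ = 1) (a : ℝ) (x : E) (hx : ⟪x, w⟫ < a)
    (R : E) (hR : R = x + (2 * (a - ⟪x, w⟫)) • w) :
    ∀ x₁ ∈ {y : E | a ≤ ⟪y, w⟫}, ∀ x₂ : E,
      dist x x₁ + dist x₁ x₂ ≥ dist R x₂ := by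
  intro x₁ hx₁ x₂
  have h1 : a ≤ ⟪x₁, w⟫ := hx₁
  have key : dist R x₁ ≤ dist x x₁ := by
    rw [dist_eq_norm, dist_eq_norm]
    have e : R - x₁ = (x - x₁) + (2 * (a - ⟪x, w⟫)) • w := by
      rw [hR]; abel
    have h2 : ‖R - x₁‖ ^ 2 ≤ ‖x - x₁‖ ^ 2 := by
      rw [e, norm_add_sq_real, inner_smul_right, inner_sub_left, norm_smul, hw, mul_one,
        Real.norm_eq_abs, sq_abs]
      nlinarith [mul_nonneg (sub_nonneg.2 hx.le) (sub_nonneg.2 h1)]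
    exact (pow_le_pow_iff_left₀ (norm_nonneg _) (norm_nonneg _) two_ne_zero).1 h2
  have := dist_triangle R x₁ x₂
  linarith
end

section
/- Work in E := EuclideanSpace ℝ (Fin 2). Let w, v ∈ E be unit vectors and a, b ∈ ℝ, with half-planes H_A := {y : ⟪y, w⟫ ≥ a} and H_B := {y : ⟪y, v⟫ ≥ b}. Suppose x satisfies ⟪x, w⟫ < a; let R := x + 2·(a − ⟪x, w⟫) • w (reflection of x across the boundary of H_A). Suppose further ⟪R, v⟫ < b, and let P := R + (b − ⟪R, v⟫) • v (the orthogonal projection of R onto the boundary line of H_B, which is the point of H_B closest to R). If ⟪P, w⟫ < a, then: (1) for all x₁ ∈ H_A and x₂ ∈ H_B, dist(x, x₁) + dist(x₁, x₂) ≥ dist(R, P); and (2) there exists x₁ lying on the segment joining R and P with ⟪x₁, w⟫ = a such that dist(x, x₁) + dist(x₁, P) = dist(R, P). Consequently the infimum of dist(x, x₁) + dist(x₁, x₂) over x₁ ∈ H_A, x₂ ∈ H_B equals dist(R, P) = b − ⟪R, v⟫ and is attained by a zig-zag strategy. -/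
open scoped RealInnerProductSpace
open Metric Set

/-- The zig-zag lemma: the least costly two-step strategy from `x` that first passes the
half-plane `H_A` and then the half-plane `H_B` costs `dist R P`, where `R` is the
reflection of `x` across the boundary of `H_A` and `P` is the projection of `R` onto the
boundary of `H_B`; moreover the optimum is attained by a zig-zag strategy whose
intermediate point lies on the segment from `R` to `P` on the boundary of `H_A`. -/
theorem zigzag_lemma
    (w v : EuclideanSpace ℝ (Fin 2)) (hw : ‖w‖ = 1) (hv : ‖v‖ = 1)
    (a b : ℝ)
    (HA HB : Set (EuclideanSpace ℝ (Fin 2)))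
    (hHA : HA = {y | a ≤ ⟪y, w⟫}) (hHB : HB = {y | b ≤ ⟪y, v⟫})
    (x : EuclideanSpace ℝ (Fin 2)) (hx : ⟪x, w⟫ < a)
    (R : EuclideanSpace ℝ (Fin 2)) (hR : R = x + (2 * (a - ⟪x, w⟫)) • w)
    (hRv : ⟪R, v⟫ < b)
    (P : EuclideanSpace ℝ (Fin 2)) (hP : P = R + (b - ⟪R, v⟫) • v)
    (hPw : ⟪P, w⟫ < a) :
    (∀ x₁ ∈ HA, ∀ x₂ ∈ HB, dist x x₁ + dist x₁ x₂ ≥ dist R P) ∧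
    (∃ x₁ ∈ segment ℝ R P, ⟪x₁, w⟫ = a ∧ dist x x₁ + dist x₁ P = dist R P) ∧
    dist R P = b - ⟪R, v⟫ := by
  have hww : ⟪w, w⟫ = 1 := by rw [real_inner_self_eq_norm_sq, hw]; norm_num
  have hRw : ⟪R, w⟫ = 2 * a - ⟪x, w⟫ := by
    rw [hR, inner_add_left, real_inner_smul_left, hww]; ring
  have key : ∀ y : EuclideanSpace ℝ (Fin 2),
      dist R y ^ 2 = dist x y ^ 2 - 4 * (a - ⟪x, w⟫) * (⟪y, w⟫ - a) := by
    intro y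
    have h1 : R - y = (x - y) + (2 * (a - ⟪x, w⟫)) • w := by rw [hR]; abel
    rw [dist_eq_norm, dist_eq_norm, h1, norm_add_sq_real, norm_smul, hw,
      real_inner_smul_right, inner_sub_left, mul_one, Real.norm_eq_abs, sq_abs]
    ring
  have hRP : dist R P = b - ⟪R, v⟫ := by
    rw [dist_eq_norm, hP, sub_add_cancel_left, norm_neg, norm_smul, hv, mul_one,
      Real.norm_eq_abs, abs_of_pos (by linarith)]
  refine ⟨?_, ?_, hRP⟩
  · intro x₁ h₁ x₂ h₂
    rw [hHA, mem_setOf_eq] at h₁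
    rw [hHB, mem_setOf_eq] at h₂
    have h3 : dist R x₁ ≤ dist x x₁ := by
      refine (sq_le_sq₀ dist_nonneg dist_nonneg).1 ?_
      rw [key]
      have := mul_nonneg (sub_nonneg.2 hx.le) (sub_nonneg.2 h₁)
      linarith
    have h4 : b - ⟪R, v⟫ ≤ dist R x₂ := by
      have h5 := real_inner_le_norm (x₂ - R) v
      rw [inner_sub_left, hv, mul_one, ← dist_eq_norm, dist_comm] at h5
      linarith
    have h6 := dist_triangle R x₁ x₂
    linarith
  · have hd : 0 < ⟪R, w⟫ - ⟪P, w⟫ := by linarith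
    set t : ℝ := (⟪R, w⟫ - a) / (⟪R, w⟫ - ⟪P, w⟫) with ht
    have ht0 : 0 ≤ t := div_nonneg (by linarith) hd.le
    have ht1 : t ≤ 1 := (div_le_one hd).2 (by linarith)
    have htm : t * (⟪R, w⟫ - ⟪P, w⟫) = ⟪R, w⟫ - a := div_mul_cancel₀ _ hd.ne'
    have hseg : (1 - t) • R + t • P ∈ segment ℝ R P :=
      ⟨1 - t, t, by linarith, ht0, by ring, rfl⟩
    have hin : ⟪(1 - t) • R + t • P, w⟫ = a := by
      rw [inner_add_left, real_inner_smul_left, real_inner_smul_left]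
      linarith
    refine ⟨_, hseg, hin, ?_⟩
    have h7 := key ((1 - t) • R + t • P)
    rw [hin, sub_self, mul_zero, sub_zero] at h7
    have h8 := (sq_eq_sq₀ dist_nonneg dist_nonneg).1 h7
    rw [← h8]
    exact dist_add_dist_of_mem_segment hseg
end

section
/- Fix two closed half-planes T_A and T_B in E := EuclideanSpace ℝ (Fin 2) and η > 0. For q ∈ [0,1] define the manipulation set M_q as the set of all x ∉ T_A ∩ T_B for which there exist x₁, x₂ ∈ E such that p(x₁,x₂) > 0 and p(x₁,x₂) − η·(dist(x, x₁) + dist(x₁, x₂)) ≥ 0, where p(x₁,x₂) := q·[x₁ ∈ T_A and x₂ ∈ T_B] + (1−q)·[x₁ ∈ T_B and x₂ ∈ T_A] (Iverson brackets). Then for every q ∈ [0, 1/2], M_q ⊆ M_0, and for every q ∈ [1/2, 1], M_q ⊆ M_1. -/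
open scoped RealInnerProductSpace Classical
open Metric Set

/-- Acceptance probability in the random-order mechanism without disclosure with tests
`(TA, TB)` and randomization probability `q`, for an agent presenting `x₁` at the first
test and `x₂` at the second test. -/
noncomputable def acceptProb (TA TB : Set (EuclideanSpace ℝ (Fin 2))) (q : ℝ)
    (x₁ x₂ : EuclideanSpace ℝ (Fin 2)) : ℝ :=
  q * (if x₁ ∈ TA ∧ x₂ ∈ TB then 1 else 0) +
    (1 - q) * (if x₁ ∈ TB ∧ x₂ ∈ TA then 1 else 0)

/-- The manipulation set `M_q`: initial attributes outside `TA ∩ TB` that can profitably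
manipulate so as to be accepted with positive probability. -/
noncomputable def manipSet (η : ℝ) (TA TB : Set (EuclideanSpace ℝ (Fin 2))) (q : ℝ) :
    Set (EuclideanSpace ℝ (Fin 2)) :=
  {x | x ∉ TA ∩ TB ∧ ∃ x₁ x₂ : EuclideanSpace ℝ (Fin 2),
    0 < acceptProb TA TB q x₁ x₂ ∧
    acceptProb TA TB q x₁ x₂ - η * (dist x x₁ + dist x₁ x₂) ≥ 0}

/-- Coverage for small `q`, for arbitrary tests: reverse the order of the two presented points. -/
lemma manipSet_subset_zero (η : ℝ) (hη : 0 < η) (TA TB : Set (EuclideanSpace ℝ (Fin 2)))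
    (q : ℝ) (h0 : 0 ≤ q) (h1 : q ≤ 1 / 2) : manipSet η TA TB q ⊆ manipSet η TA TB 0 := by
  rintro x ⟨hx, x₁, x₂, hp, hc⟩
  refine ⟨hx, ?_⟩
  by_cases hB : x₁ ∈ TB ∧ x₂ ∈ TA
  · refine ⟨x₁, x₂, ?_, ?_⟩
    · simp [acceptProb, hB]
    · have hle : acceptProb TA TB q x₁ x₂ ≤ 1 := by
        unfold acceptProb
        rw [if_pos hB]
        split_ifs <;> linarith
      have he : acceptProb TA TB 0 x₁ x₂ = 1 := by simp [acceptProb, hB]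
      rw [he]
      linarith
  · by_cases hA : x₁ ∈ TA ∧ x₂ ∈ TB
    · have he : acceptProb TA TB 0 x₂ x₁ = 1 := by simp [acceptProb, hA]
      have hq : acceptProb TA TB q x₁ x₂ = q := by
        unfold acceptProb
        rw [if_pos hA, if_neg hB]
        ring
      refine ⟨x₂, x₁, by rw [he]; norm_num, ?_⟩
      rw [he]
      rw [hq] at hc
      have ht : dist x x₂ + dist x₂ x₁ ≤ 2 * (dist x x₁ + dist x₁ x₂) := by
        have := dist_triangle x x₁ x₂
        have := dist_comm x₁ x₂
        have := dist_nonneg (x := x) (y := x₁)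
        linarith
      have := mul_le_mul_of_nonneg_left ht hη.le
      linarith
    · unfold acceptProb at hp
      rw [if_neg hA, if_neg hB] at hp
      linarith

/-- Swapping the roles of the two tests. -/
lemma manipSet_swap (η : ℝ) (TA TB : Set (EuclideanSpace ℝ (Fin 2))) (q : ℝ) :
    manipSet η TA TB q = manipSet η TB TA (1 - q) := by
  have h : ∀ x₁ x₂, acceptProb TA TB q x₁ x₂ = acceptProb TB TA (1 - q) x₁ x₂ := by
    intro x₁ x₂
    unfold acceptProb
    ring
  unfold manipSet
  simp only [h, Set.inter_comm TA TB]

/-- Coverage of the manipulation sets: for `q ≤ 1/2` we have `M_q ⊆ M_0`, and for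
`q ≥ 1/2` we have `M_q ⊆ M_1`. -/
theorem manipSet_coverage
    (η : ℝ) (hη : 0 < η)
    (u v : EuclideanSpace ℝ (Fin 2)) (hu : ‖u‖ = 1) (hv : ‖v‖ = 1)
    (a b : ℝ)
    (TA TB : Set (EuclideanSpace ℝ (Fin 2)))
    (hTA : TA = {x | a ≤ ⟪x, u⟫}) (hTB : TB = {x | b ≤ ⟪x, v⟫}) :
    (∀ q ∈ Set.Icc (0 : ℝ) (1 / 2), manipSet η TA TB q ⊆ manipSet η TA TB 0) ∧
    (∀ q ∈ Set.Icc (1 / 2 : ℝ) 1, manipSet η TA TB q ⊆ manipSet η TA TB 1) := by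
  refine ⟨fun q hq => manipSet_subset_zero η hη TA TB q hq.1 hq.2, fun q hq => ?_⟩
  rw [manipSet_swap η TA TB q, manipSet_swap η TA TB 1, sub_self]
  exact manipSet_subset_zero η hη TB TA (1 - q) (by linarith [hq.2]) (by linarith [hq.1])
end

section
/- Let E := EuclideanSpace ℝ (Fin 2), let r ≥ 0, and let S ⊆ E be nonempty. Define H := convexHull ℝ (⋃_{o ∈ S} Metric.closedBall o r) and Q := {x : Metric.closedBall x r ⊆ H}. Then for every x ∈ H there exists q ∈ Q with dist(x, q) ≤ r; in particular every point of H is within distance r of Q, i.e., infDist(x, Q) ≤ r for all x ∈ H. Moreover S ⊆ Q and the convex hull of S is contained in Q. -/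
open Metric Set

/-- If the qualified region `H` is the convex hull of a union of balls of radius `r`,
then every point of `H` is within distance `r` of the immediately accepted region
`Q = {x | closedBall x r ⊆ H}`; moreover the ball centers and their convex hull lie
in `Q`. -/
theorem convexHull_of_balls_within_dist_of_erosion
    (r : ℝ) (hr : 0 ≤ r)
    (S : Set (EuclideanSpace ℝ (Fin 2))) (hS : S.Nonempty)
    (H Q : Set (EuclideanSpace ℝ (Fin 2)))
    (hH : H = convexHull ℝ (⋃ o ∈ S, Metric.closedBall o r))
    (hQ : Q = {x | Metric.closedBall x r ⊆ H}) :
    (∀ x ∈ H, ∃ q ∈ Q, dist x q ≤ r) ∧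
    (∀ x ∈ H, Metric.infDist x Q ≤ r) ∧
    S ⊆ Q ∧ convexHull ℝ S ⊆ Q := by
  have hHc : Convex ℝ H := hH ▸ convex_convexHull ℝ _
  have hSQ : S ⊆ Q := by
    intro o ho
    rw [hQ, hH]
    exact (subset_biUnion_of_mem (u := fun o => Metric.closedBall o r) ho).trans
      (subset_convexHull ℝ _)
  have hQc : Convex ℝ Q := by
    intro x hx y hy a b ha hb hab
    rw [hQ] at hx hy ⊢
    intro w hw
    rw [mem_closedBall, dist_eq_norm] at hw
    have h1 : x + (w - (a • x + b • y)) ∈ H :=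
      hx (by rw [mem_closedBall, dist_eq_norm, add_sub_cancel_left]; exact hw)
    have h2 : y + (w - (a • x + b • y)) ∈ H :=
      hy (by rw [mem_closedBall, dist_eq_norm, add_sub_cancel_left]; exact hw)
    have h3 := hHc h1 h2 ha hb hab
    have h4 : a • (x + (w - (a • x + b • y))) + b • (y + (w - (a • x + b • y))) = w := by
      obtain rfl : b = 1 - a := by linarith
      module
    rwa [h4] at h3
  have hmain : ∀ x ∈ H, ∃ q ∈ Q, dist x q ≤ r := by
    intro x hx
    have hsub : H ⊆ Set.image2 (fun u v => u + v) Q (Metric.closedBall 0 r) := by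
      rw [hH]
      refine convexHull_min ?_ (hQc.add (convex_closedBall 0 r))
      intro z hz
      obtain ⟨o, ho, hz⟩ := mem_iUnion₂.1 hz
      refine ⟨o, hSQ ho, z - o, ?_, by simp⟩
      rw [mem_closedBall, dist_eq_norm] at hz
      simpa using hz
    obtain ⟨q, hq, v, hv, rfl⟩ := hsub hx
    refine ⟨q, hq, ?_⟩
    simpa [dist_eq_norm] using hv
  refine ⟨hmain, ?_, hSQ, convexHull_min hSQ hQc⟩
  intro x hx
  obtain ⟨q, hq, h⟩ := hmain x hx
  exact (Metric.infDist_le_dist_of_mem hq).trans h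
end

section
/- Let E := EuclideanSpace ℝ (Fin 2), let r ≥ 0, and let H ⊆ E be a nonempty convex set. Define Q := {x : Metric.closedBall x r ⊆ H}. Then the following are equivalent: (i) there exists a nonempty set S ⊆ E with H = convexHull ℝ (⋃_{o ∈ S} Metric.closedBall o r); (ii) H = ⋃_{q ∈ Q} Metric.closedBall q r. -/
open Metric Set

open scoped Pointwise in
lemma biUnion_closedBall_eq_add (r : ℝ) (S : Set (EuclideanSpace ℝ (Fin 2))) :
    (⋃ o ∈ S, Metric.closedBall o r) = S + Metric.closedBall 0 r := by
  ext x
  simp only [Set.mem_iUnion, Set.mem_add, exists_prop]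
  constructor
  · rintro ⟨o, ho, hx⟩
    exact ⟨o, ho, x - o, by simpa [dist_eq_norm] using hx, by abel⟩
  · rintro ⟨o, ho, b, hb, rfl⟩
    exact ⟨o, ho, by simpa [dist_eq_norm] using hb⟩

/-- A nonempty convex set `H` in the plane is the convex hull of a union of balls of
radius `r` if and only if `H` is covered by the `r`-balls centered at its erosion
`Q = {x | closedBall x r ⊆ H}`. -/
theorem convexHull_of_balls_iff_union_of_erosion_balls
    (r : ℝ) (hr : 0 ≤ r)
    (H : Set (EuclideanSpace ℝ (Fin 2))) (hne : H.Nonempty) (hconv : Convex ℝ H)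
    (Q : Set (EuclideanSpace ℝ (Fin 2)))
    (hQ : Q = {x | Metric.closedBall x r ⊆ H}) :
    (∃ S : Set (EuclideanSpace ℝ (Fin 2)), S.Nonempty ∧
        H = convexHull ℝ (⋃ o ∈ S, Metric.closedBall o r)) ↔
      H = ⋃ q ∈ Q, Metric.closedBall q r := by
  constructor
  · rintro ⟨S, -, hS⟩
    have key : H = ⋃ o ∈ convexHull ℝ S, Metric.closedBall o r := by
      rw [hS, biUnion_closedBall_eq_add, biUnion_closedBall_eq_add, convexHull_add,
        (convex_closedBall (0 : EuclideanSpace ℝ (Fin 2)) r).convexHull_eq]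
    subst hQ
    apply Set.Subset.antisymm
    · intro x hx
      rw [key] at hx
      simp only [Set.mem_iUnion, exists_prop] at hx ⊢
      obtain ⟨q, hq, hxq⟩ := hx
      refine ⟨q, ?_, hxq⟩
      intro y hy
      rw [key]
      simp only [Set.mem_iUnion, exists_prop]
      exact ⟨q, hq, hy⟩
    · exact Set.iUnion₂_subset fun q hq => hq
  · intro h
    refine ⟨Q, ?_, ?_⟩
    · obtain ⟨x, hx⟩ := hne
      rw [h] at hx
      simp only [Set.mem_iUnion, exists_prop] at hx
      obtain ⟨q, hq, -⟩ := hx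
      exact ⟨q, hq⟩
    · rw [← h, hconv.convexHull_eq]
end

section
/- Let E := EuclideanSpace ℝ (Fin 2). Let c : E → E → E → ℝ be a cost function satisfying: (i) one-step consistency: c x y y = c x x y for all x, y; (ii) translation invariance: c (x+v) (y+v) (z+v) = c x y z for all x, y, z, v; (iii) triangle inequality: c x y z ≥ c x x z for all x, y, z; (iv) monotonicity: c x y z ≥ c x x y for all x, y, z. Write C x y := c x x y. Let w_A, w_B ∈ E be linearly independent unit vectors, a, b ∈ ℝ, and define the criteria h_A := {x : ⟪x, w_A⟫ ≥ 0}, h_B := {x : ⟪x, w_B⟫ ≥ 0} and the tests T_A := {x : ⟪x, w_A⟫ ≥ a}, T_B := {x : ⟪x, w_B⟫ ≥ b}. Define SimAcc := {x : ∃ y ∈ T_A ∩ T_B, C x y ≤ 1} and FixAcc := {x : ∃ x₁ ∈ T_A, ∃ x₂ ∈ T_B, c x x₁ x₂ ≤ 1}. If SimAcc ⊆ h_A ∩ h_B, then FixAcc ⊆ h_A ∩ h_B and SimAcc ⊆ FixAcc. (If the simultaneous mechanism with tests (T_A, T_B) is feasible, then the fixed-order sequential mechanism applying T_A first and T_B second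 is also feasible and weakly better.) -/
open scoped RealInnerProductSpace
open Metric Set

lemma exists_shift (p q : EuclideanSpace ℝ (Fin 2)) (hp : ‖p‖ = 1) (hq : ‖q‖ = 1)
    (h : LinearIndependent ℝ ![p, q]) (r : ℝ) :
    ∃ v : EuclideanSpace ℝ (Fin 2), ⟪v, p⟫ = 0 ∧ ⟪v, q⟫ = r := by
  have hpp : ⟪p, p⟫ = 1 := by rw [real_inner_self_eq_norm_sq, hp]; norm_num
  have hqq : ⟪q, q⟫ = 1 := by rw [real_inner_self_eq_norm_sq, hq]; norm_num
  have hc : ⟪q, p⟫ = ⟪p, q⟫ := real_inner_comm _ _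
  have hs : 1 - ⟪p, q⟫ * ⟪p, q⟫ ≠ 0 := by
    intro h0
    have h1 : q - ⟪p, q⟫ • p = 0 := by
      rw [← inner_self_eq_zero (𝕜 := ℝ)]
      simp only [inner_sub_left, inner_sub_right, real_inner_smul_left, real_inner_smul_right,
        hpp, hqq, hc]
      linarith
    have h2 := (LinearIndependent.pair_iff.1 h) (-⟪p, q⟫) 1 (by
      rw [← h1]; module)
    exact one_ne_zero h2.2
  refine ⟨(r / (1 - ⟪p, q⟫ * ⟪p, q⟫)) • (q - ⟪p, q⟫ • p), ?_, ?_⟩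
  · simp only [inner_sub_left, real_inner_smul_left, hpp, hc]
    ring
  · simp only [inner_sub_left, real_inner_smul_left, hqq]
    exact div_mul_cancel₀ r hs

/-- General cost functions, manipulation setting: if the simultaneous mechanism with
parallel-shifted tests `(T_A, T_B)` is feasible (accepts only qualified agents), then
the fixed-order sequential mechanism applying `T_A` first and `T_B` second is also
feasible and weakly better. -/
theorem fixedOrder_feasible_and_better_generalCost
    (c : EuclideanSpace ℝ (Fin 2) → EuclideanSpace ℝ (Fin 2) →
      EuclideanSpace ℝ (Fin 2) → ℝ)
    (hone : ∀ x y : EuclideanSpace ℝ (Fin 2), c x y y = c x x y)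
    (htrans : ∀ x y z v : EuclideanSpace ℝ (Fin 2),
      c (x + v) (y + v) (z + v) = c x y z)
    (htri : ∀ x y z : EuclideanSpace ℝ (Fin 2), c x y z ≥ c x x z)
    (hmono : ∀ x y z : EuclideanSpace ℝ (Fin 2), c x y z ≥ c x x y)
    (wA wB : EuclideanSpace ℝ (Fin 2))
    (hwA : ‖wA‖ = 1) (hwB : ‖wB‖ = 1) (hindep : LinearIndependent ℝ ![wA, wB])
    (a b : ℝ)
    (hA hB TA TB SimAcc FixAcc : Set (EuclideanSpace ℝ (Fin 2)))
    (hhA : hA = {x | 0 ≤ ⟪x, wA⟫}) (hhB : hB = {x | 0 ≤ ⟪x, wB⟫})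
    (hTA : TA = {x | a ≤ ⟪x, wA⟫}) (hTB : TB = {x | b ≤ ⟪x, wB⟫})
    (hSimAcc : SimAcc = {x | ∃ y ∈ TA ∩ TB, c x x y ≤ 1})
    (hFixAcc : FixAcc = {x | ∃ x₁ ∈ TA, ∃ x₂ ∈ TB, c x x₁ x₂ ≤ 1})
    (hfeas : SimAcc ⊆ hA ∩ hB) :
    FixAcc ⊆ hA ∩ hB ∧ SimAcc ⊆ FixAcc := by
  subst hhA hhB hTA hTB hSimAcc hFixAcc
  constructor
  · rintro x ⟨x₁, h₁, x₂, h₂, hx⟩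
    simp only [mem_ofPred_eq] at h₁ h₂
    constructor
    · obtain ⟨v, hv, hv'⟩ := exists_shift wA wB hwA hwB hindep (b - ⟪x₁, wB⟫)
      have := (@hfeas (x + v) ⟨x₁ + v, ⟨by simp [inner_add_left, hv, h₁],
        by simp [inner_add_left, hv']⟩, by rw [htrans]; exact (hmono _ _ _).le.trans hx⟩).1
      simpa [inner_add_left, hv] using this
    · obtain ⟨v, hv, hv'⟩ := exists_shift wB wA hwB hwA
        (LinearIndependent.pair_symm_iff.1 hindep) (a - ⟪x₂, wA⟫)
      have := (@hfeas (x + v) ⟨x₂ + v, ⟨by simp [inner_add_left, hv'],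
        by simp [inner_add_left, hv, h₂]⟩, by rw [htrans]; exact (htri _ _ _).le.trans hx⟩).2
      simpa [inner_add_left, hv] using this
  · rintro x ⟨y, ⟨h₁, h₂⟩, hy⟩
    exact ⟨y, h₁, y, h₂, by rw [hone]; exact hy⟩
end
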